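/- arXiv:2604.14308 — 2 statements merged into one kernel-verified Lean document; each statement's English description precedes it below -/
import Mathlib

section
/- Let f : ℝⁿ → ℝⁿ, G : ℝⁿ → ℝ^{n×m}, Φ : ℝⁿ → ℝ^{m×p} be continuous, h : ℝⁿ → ℝ continuously differentiable, θ ∈ ℝᵖ, Γ ∈ ℝ^{p×p} symmetric positive definite, and let α : ℝ → ℝ be locally Lipschitz, strictly increasing, with α(0) = 0. Define ψ(x) := (∇h(x)ᵀ G(x) Φ(x))ᵀ and h_a(x, θ̂) := h(x) − ½ (θ − θ̂)ᵀ Γ⁻¹ (θ − θ̂). Let T ∈ (0, ∞] and let x : [0, T) → ℝⁿ, θ̂ : [0, T) → ℝᵖ, u : [0, T) → ℝᵐ, ϑ̃ : [0, T) → ℝᵖ be such that x, θ̂ are differentiable with x′(t) = f(x(t)) + G(x(t))(u(t) + Φ(x(t)) θ) and θ̂′(t) = −Γ ψ(x(t)), the weighted parameter-error bound (θ − θ̂(t))ᵀ Γ⁻¹ (θ − θ̂(t)) ≤ ϑ̃(t)ᵀ Γ⁻¹ ϑ̃(t) holds, and the RaCBF condition ∇h(x(t)) ⋅ ( f(x(t))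 + G(x(t))(u(t) + Φ(x(t)) θ̂(t)) ) ≥ −α( h(x(t)) − ½ ϑ̃(t)ᵀ Γ⁻¹ ϑ̃(t) ) holds for all t ∈ [0, T). If h_a(x(0), θ̂(0)) ≥ 0, then h_a(x(t), θ̂(t)) ≥ 0 and h(x(t)) ≥ 0 for all t ∈ [0, T). -/
open Matrix

/-- `ψ(x) := (∇h(x)ᵀ G(x) Φ(x))ᵀ ∈ ℝᵖ`. -/
noncomputable def psi {n m p : ℕ} (h : (Fin n → ℝ) → ℝ)
    (G : (Fin n → ℝ) → Matrix (Fin n) (Fin m) ℝ)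
    (Φ : (Fin n → ℝ) → Matrix (Fin m) (Fin p) ℝ)
    (x : Fin n → ℝ) : Fin p → ℝ :=
  fun j => fderiv ℝ h x (fun i => (G x * Φ x) i j)

/-- Augmented barrier candidate `h_a(x, θ̂) := h(x) - ½ (θ - θ̂)ᵀ Γ⁻¹ (θ - θ̂)`. -/
noncomputable def hA {n p : ℕ} (h : (Fin n → ℝ) → ℝ) (θ : Fin p → ℝ)
    (Γ : Matrix (Fin p) (Fin p) ℝ) (x : Fin n → ℝ) (θhat : Fin p → ℝ) : ℝ :=
  h x - (1 / 2) * ((θ - θhat) ⬝ᵥ (Γ⁻¹ *ᵥ (θ - θhat)))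

/-- A scalar function whose derivative is positive wherever the function is negative
stays nonnegative once it starts nonnegative. -/
theorem nonneg_of_hasDerivAt_pos_of_neg {g g' : ℝ → ℝ} {a b : ℝ} (hab : a ≤ b)
    (hg : ∀ t ∈ Set.Icc a b, HasDerivAt g (g' t) t) (ha : 0 ≤ g a)
    (hpos : ∀ t ∈ Set.Icc a b, g t < 0 → 0 < g' t) : 0 ≤ g b := by
  refine le_of_forall_pos_le_add fun ε hε => ?_
  have key := image_le_of_deriv_right_lt_deriv_boundary (f := fun t => -g t)
    (f' := fun t => -g' t) (a := a) (b := b) (B := fun _ => ε) (B' := fun _ => 0)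
    (fun t ht => (hg t ht).continuousAt.neg.continuousWithinAt)
    (fun t ht => (hg t (Set.Ico_subset_Icc_self ht)).neg.hasDerivWithinAt)
    (by linarith) (fun t => hasDerivAt_const t ε)
    (fun t ht hgt => by
      have := hpos t (Set.Ico_subset_Icc_self ht) (by linarith)
      linarith)
    (Set.right_mem_Icc.2 hab)
  linarith

/-- The derivative of a quadratic form with symmetric matrix along a curve. -/
theorem HasDerivAt.dotProduct_mulVec_self {p : ℕ} {A : Matrix (Fin p) (Fin p) ℝ}
    (hA : A.IsSymm) {e : ℝ → Fin p → ℝ} {e' : Fin p → ℝ} {t : ℝ} (he : HasDerivAt e e' t) :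
    HasDerivAt (fun s => e s ⬝ᵥ (A *ᵥ e s)) (2 * (e t ⬝ᵥ (A *ᵥ e'))) t := by
  have hi := hasDerivAt_pi.1 he
  have hAe : ∀ i, HasDerivAt (fun s => (A *ᵥ e s) i) ((A *ᵥ e') i) t := fun i => by
    simpa only [mulVec, dotProduct] using
      HasDerivAt.fun_sum (u := Finset.univ) fun j _ => (hi j).const_mul (A i j)
  have hsum : HasDerivAt (fun s => e s ⬝ᵥ (A *ᵥ e s))
      (e' ⬝ᵥ (A *ᵥ e t) + e t ⬝ᵥ (A *ᵥ e')) t := by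
    have := HasDerivAt.fun_sum (u := Finset.univ) fun i _ => (hi i).fun_mul (hAe i)
    simpa only [dotProduct, Finset.sum_add_distrib] using this
  have hsymm : e' ⬝ᵥ (A *ᵥ e t) = e t ⬝ᵥ (A *ᵥ e') := by
    rw [dotProduct_mulVec, ← mulVec_transpose, hA.eq, dotProduct_comm]
  rw [hsymm, ← two_mul] at hsum
  exact hsum

/-- `ψ(x) ⬝ v` is the derivative of `h` at `x` in the direction `G(x) Φ(x) v`. -/
theorem dotProduct_psi {n m p : ℕ} (h : (Fin n → ℝ) → ℝ)
    (G : (Fin n → ℝ) → Matrix (Fin n) (Fin m) ℝ)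
    (Φ : (Fin n → ℝ) → Matrix (Fin m) (Fin p) ℝ) (x : Fin n → ℝ) (v : Fin p → ℝ) :
    v ⬝ᵥ psi h G Φ x = fderiv ℝ h x (G x *ᵥ (Φ x *ᵥ v)) := by
  have hv : G x *ᵥ (Φ x *ᵥ v) = ∑ j, v j • fun i => (G x * Φ x) i j := by
    rw [mulVec_mulVec]
    ext i
    simp [mulVec, dotProduct, mul_comm]
  simp [hv, psi, dotProduct]

/-- Under the update law `θ̂' = -Γ ψ(x)`, the derivative of the augmented barrier candidate
is the derivative of `h` along the dynamics with `θ` replaced by its estimate. -/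
theorem hasDerivAt_hA {n m p : ℕ} {f : (Fin n → ℝ) → (Fin n → ℝ)}
    {G : (Fin n → ℝ) → Matrix (Fin n) (Fin m) ℝ}
    {Φ : (Fin n → ℝ) → Matrix (Fin m) (Fin p) ℝ}
    {h : (Fin n → ℝ) → ℝ} {θ : Fin p → ℝ} {Γ : Matrix (Fin p) (Fin p) ℝ} (hΓ : Γ.PosDef)
    {x : ℝ → Fin n → ℝ} {θhat : ℝ → Fin p → ℝ} {w : Fin m → ℝ} {t : ℝ}
    (hh : DifferentiableAt ℝ h (x t))
    (hx : HasDerivAt x (f (x t) + G (x t) *ᵥ (w + Φ (x t) *ᵥ θ)) t)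
    (hθhat : HasDerivAt θhat (-(Γ *ᵥ psi h G Φ (x t))) t) :
    HasDerivAt (fun s => hA h θ Γ (x s) (θhat s))
      (fderiv ℝ h (x t) (f (x t) + G (x t) *ᵥ (w + Φ (x t) *ᵥ θhat t))) t := by
  have hsymm : Γ⁻¹.IsSymm :=
    (conjTranspose_eq_transpose_of_trivial _).symm.trans hΓ.inv.isHermitian
  have hq := ((hθhat.const_sub θ).dotProduct_mulVec_self hsymm).const_mul (1 / 2 : ℝ)
  have hd := (hh.hasFDerivAt.comp_hasDerivAt t hx).sub hq
  have hinv : Γ⁻¹ *ᵥ (Γ *ᵥ psi h G Φ (x t)) = psi h G Φ (x t) := by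
    rw [mulVec_mulVec, nonsing_inv_mul _ ((isUnit_iff_isUnit_det _).1 hΓ.isUnit), one_mulVec]
  refine hd.congr_deriv ?_
  rw [neg_neg, hinv, dotProduct_psi]
  simp only [mulVec_add, mulVec_sub, map_add, map_sub]
  ring

/-- RaCBF invariance: under the update law `θ̂' = -Γ ψ(x)`, the weighted
parameter-error bound, and the RaCBF condition with an extended class-K∞ locally
Lipschitz `α`, nonnegativity of the augmented barrier candidate is forward invariant,
and hence `h (x t) ≥ 0` along the trajectory. -/
theorem stmt_4 {n m p : ℕ}
    (f : (Fin n → ℝ) → (Fin n → ℝ))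
    (G : (Fin n → ℝ) → Matrix (Fin n) (Fin m) ℝ)
    (Φ : (Fin n → ℝ) → Matrix (Fin m) (Fin p) ℝ)
    (hf : Continuous f) (hG : Continuous G) (hΦ : Continuous Φ)
    (h : (Fin n → ℝ) → ℝ) (hh : ContDiff ℝ 1 h)
    (θ : Fin p → ℝ) (Γ : Matrix (Fin p) (Fin p) ℝ) (hΓ : Γ.PosDef)
    (α : ℝ → ℝ) (hα : LocallyLipschitz α) (hmono : StrictMono α) (hα0 : α 0 = 0)
    (T : EReal) (hT : 0 < T)
    (x : ℝ → Fin n → ℝ) (θhat : ℝ → Fin p → ℝ) (u : ℝ → Fin m → ℝ)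
    (ϑ : ℝ → Fin p → ℝ)
    (hx : ∀ t : ℝ, 0 ≤ t → (t : EReal) < T →
      HasDerivAt x (f (x t) + G (x t) *ᵥ (u t + Φ (x t) *ᵥ θ)) t)
    (hθhat : ∀ t : ℝ, 0 ≤ t → (t : EReal) < T →
      HasDerivAt θhat (-(Γ *ᵥ psi h G Φ (x t))) t)
    (herr : ∀ t : ℝ, 0 ≤ t → (t : EReal) < T →
      (θ - θhat t) ⬝ᵥ (Γ⁻¹ *ᵥ (θ - θhat t)) ≤ ϑ t ⬝ᵥ (Γ⁻¹ *ᵥ ϑ t))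
    (hracbf : ∀ t : ℝ, 0 ≤ t → (t : EReal) < T →
      fderiv ℝ h (x t) (f (x t) + G (x t) *ᵥ (u t + Φ (x t) *ᵥ θhat t)) ≥
        -α (h (x t) - (1 / 2) * (ϑ t ⬝ᵥ (Γ⁻¹ *ᵥ ϑ t))))
    (h0 : hA h θ Γ (x 0) (θhat 0) ≥ 0) :
    ∀ t : ℝ, 0 ≤ t → (t : EReal) < T →
      hA h θ Γ (x t) (θhat t) ≥ 0 ∧ h (x t) ≥ 0 := by
  intro t ht0 htT
  have hlt : ∀ s ∈ Set.Icc 0 t, (s : EReal) < T := fun s hs =>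
    (EReal.coe_le_coe_iff.2 hs.2).trans_lt htT
  have hnonneg : 0 ≤ hA h θ Γ (x t) (θhat t) := by
    refine nonneg_of_hasDerivAt_pos_of_neg (g := fun s => hA h θ Γ (x s) (θhat s)) ht0
      (fun s hs => hasDerivAt_hA (w := u s) hΓ (hh.differentiable one_ne_zero (x s))
        (hx s hs.1 (hlt s hs)) (hθhat s hs.1 (hlt s hs))) h0 fun s hs hneg => ?_
    have hle : h (x s) - (1 / 2) * (ϑ s ⬝ᵥ (Γ⁻¹ *ᵥ ϑ s)) ≤ hA h θ Γ (x s) (θhat s) := by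
      have := herr s hs.1 (hlt s hs)
      unfold hA
      linarith
    have hαneg := hmono (hle.trans_lt hneg)
    have := hracbf s hs.1 (hlt s hs)
    linarith
  have hquad : 0 ≤ (θ - θhat t) ⬝ᵥ (Γ⁻¹ *ᵥ (θ - θhat t)) := by
    simpa using hΓ.inv.posSemidef.dotProduct_mulVec_nonneg (θ - θhat t)
  refine ⟨hnonneg, ?_⟩
  unfold hA at hnonneg
  linarith
end

section
/- Under the setting of the high-order tuner derivative identity, additionally assume: (i) λ > 0 satisfies zᵀ Γ z ≥ λ‖z‖² for all z ∈ ℝᵖ; (ii) there is ϑ̃ : [0, T) → ℝᵖ with (θ − ν(t))ᵀ Γ⁻¹ (θ − ν(t)) ≤ ϑ̃(t)ᵀ Γ⁻¹ ϑ̃(t) for all t; (iii) α > 0 and the T-RaCBF condition ∇h(x(t)) ⋅ ( f(x(t)) + G(x(t))(u(t) + Φ(x(t)) θ̂(t)) ) ≥ −α[ h(x(t)) − ½ ϑ̃(t)ᵀ Γ⁻¹ ϑ̃(t) ] + (2/β) ‖ψ(x(t))‖² holds for all t ∈ [0, T). Then, writing ν̃(t) := ν(t) − θ̂(t), for all t ∈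 [0, T): d/dt [h_a(x(t), ν(t), θ̂(t))] ≥ −α h_a(x(t), ν(t), θ̂(t)) + ½ (β − α/λ) ‖ν̃(t)‖². -/
open Matrix

/-- High-order tuner augmented barrier candidate
`h_a(x, ν, θ̂) := h(x) - ½ (θ - ν)ᵀ Γ⁻¹ (θ - ν) - ½ (ν - θ̂)ᵀ Γ⁻¹ (ν - θ̂)`. -/
noncomputable def hAhot {n p : ℕ} (h : (Fin n → ℝ) → ℝ) (θ : Fin p → ℝ)
    (Γ : Matrix (Fin p) (Fin p) ℝ) (x : Fin n → ℝ) (ν θhat : Fin p → ℝ) : ℝ :=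
  h x - (1 / 2) * ((θ - ν) ⬝ᵥ (Γ⁻¹ *ᵥ (θ - ν)))
      - (1 / 2) * ((ν - θhat) ⬝ᵥ (Γ⁻¹ *ᵥ (ν - θhat)))

/-- The differential of `h` applied to the columns of `G Φ` is dual to `psi`. -/
theorem fderiv_mulVec_mulVec {n m p : ℕ} (h : (Fin n → ℝ) → ℝ)
    (G : (Fin n → ℝ) → Matrix (Fin n) (Fin m) ℝ)
    (Φ : (Fin n → ℝ) → Matrix (Fin m) (Fin p) ℝ)
    (x : Fin n → ℝ) (v : Fin p → ℝ) :
    fderiv ℝ h x (G x *ᵥ (Φ x *ᵥ v)) = psi h G Φ x ⬝ᵥ v := by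
  rw [mulVec_mulVec, mulVec_eq_sum, map_sum]
  refine Finset.sum_congr rfl fun j _ => ?_
  rw [op_smul_eq_smul, map_smul, smul_eq_mul, mul_comm]
  rfl

theorem HasDerivAt.dotProduct {ι : Type*} [Fintype ι] {a b : ℝ → ι → ℝ} {a' b' : ι → ℝ} {t : ℝ}
    (ha : HasDerivAt a a' t) (hb : HasDerivAt b b' t) :
    HasDerivAt (fun τ => a τ ⬝ᵥ b τ) (a' ⬝ᵥ b t + a t ⬝ᵥ b') t := by
  have key := HasDerivAt.fun_sum (u := Finset.univ) fun i _ =>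
    (hasDerivAt_pi.1 ha i).fun_mul (hasDerivAt_pi.1 hb i)
  rw [Finset.sum_add_distrib] at key
  exact key

theorem HasDerivAt.matrix_mulVec {ι κ : Type*} [Fintype ι] [Fintype κ] (A : Matrix κ ι ℝ)
    {a : ℝ → ι → ℝ} {a' : ι → ℝ} {t : ℝ} (ha : HasDerivAt a a' t) :
    HasDerivAt (fun τ => A *ᵥ a τ) (A *ᵥ a') t :=
  hasDerivAt_pi.2 fun i => by
    have key := (hasDerivAt_const t (A i)).dotProduct ha
    rw [zero_dotProduct, zero_add] at key
    exact key

/-- Derivative of the quadratic form of `Γ⁻¹` along a curve with velocity `Γ v`. -/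
theorem Matrix.PosDef.hasDerivAt_inv_quadratic {ι : Type*} [Fintype ι] [DecidableEq ι]
    {Γ : Matrix ι ι ℝ} (hΓ : Γ.PosDef) {a : ℝ → ι → ℝ} {v : ι → ℝ} {t : ℝ}
    (ha : HasDerivAt a (Γ *ᵥ v) t) :
    HasDerivAt (fun τ => a τ ⬝ᵥ (Γ⁻¹ *ᵥ a τ)) (2 * (a t ⬝ᵥ v)) t := by
  have hdet : IsUnit Γ.det := (isUnit_iff_isUnit_det Γ).1 hΓ.isUnit
  have hsymm : Γᵀ = Γ := by simpa using hΓ.isHermitian.eq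
  convert ha.dotProduct (ha.matrix_mulVec Γ⁻¹) using 1
  have hleft : (Γ *ᵥ v) ⬝ᵥ (Γ⁻¹ *ᵥ a t) = a t ⬝ᵥ v := by
    rw [dotProduct_comm, dotProduct_mulVec, ← mulVec_transpose, hsymm, mulVec_mulVec,
      mul_nonsing_inv Γ hdet, one_mulVec]
  rw [hleft, mulVec_mulVec, nonsing_inv_mul Γ hdet, one_mulVec, two_mul]

/-- A lower bound `lam` on the quadratic form of `Γ` gives the upper bound `1 / lam` on that of
`Γ⁻¹`. -/
theorem Matrix.mul_dotProduct_inv_mulVec_le {ι : Type*} [Fintype ι] [DecidableEq ι]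
    {Γ : Matrix ι ι ℝ} (hdet : IsUnit Γ.det) {lam : ℝ} (hlam : 0 ≤ lam)
    (hΓlow : ∀ z : ι → ℝ, lam * (z ⬝ᵥ z) ≤ z ⬝ᵥ (Γ *ᵥ z)) (w : ι → ℝ) :
    lam * (w ⬝ᵥ (Γ⁻¹ *ᵥ w)) ≤ w ⬝ᵥ w := by
  have hlow := hΓlow (Γ⁻¹ *ᵥ w)
  rw [mulVec_mulVec, mul_nonsing_inv Γ hdet, one_mulVec] at hlow
  have hsq : 0 ≤ (w - lam • (Γ⁻¹ *ᵥ w)) ⬝ᵥ (w - lam • (Γ⁻¹ *ᵥ w)) :=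
    Finset.sum_nonneg fun _ _ => mul_self_nonneg _
  simp only [sub_dotProduct, dotProduct_sub, smul_dotProduct, dotProduct_smul, smul_eq_mul,
    dotProduct_comm (Γ⁻¹ *ᵥ w) w] at hsq hlow
  nlinarith [mul_le_mul_of_nonneg_left hlow hlam]

/-- Young's inequality for the cross term, with weight `β`. -/
theorem two_mul_dotProduct_young {ι : Type*} [Fintype ι] {β : ℝ} (hβ : 0 < β) (a b : ι → ℝ) :
    0 ≤ 2 / β * (a ⬝ᵥ a) + 2 * (a ⬝ᵥ b) + β / 2 * (b ⬝ᵥ b) := by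
  have hsq : 0 ≤ ((2 / β) • a + b) ⬝ᵥ ((2 / β) • a + b) :=
    Finset.sum_nonneg fun _ _ => mul_self_nonneg _
  simp only [add_dotProduct, dotProduct_add, smul_dotProduct, dotProduct_smul, smul_eq_mul,
    dotProduct_comm b a] at hsq
  have hmul := mul_nonneg (half_pos hβ).le hsq
  field_simp at hmul ⊢
  linarith

/-- under the high-order tuner dynamics, a lower eigenvalue bound `lam` on
`Γ`, the weighted intermediate-error bound with `ϑ̃`, and the T-RaCBF condition
(with `α > 0`), the derivative of the augmented barrier candidate satisfies
`d/dt h_a ≥ -α h_a + ½ (β - α/lam) ‖ν̃‖²` where `ν̃ := ν - θ̂`. -/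
theorem stmt_6 {n m p : ℕ}
    (f : (Fin n → ℝ) → (Fin n → ℝ))
    (G : (Fin n → ℝ) → Matrix (Fin n) (Fin m) ℝ)
    (Φ : (Fin n → ℝ) → Matrix (Fin m) (Fin p) ℝ)
    (hf : Continuous f) (hG : Continuous G) (hΦ : Continuous Φ)
    (h : (Fin n → ℝ) → ℝ) (hh : ContDiff ℝ 1 h)
    (θ : Fin p → ℝ) (Γ : Matrix (Fin p) (Fin p) ℝ) (hΓ : Γ.PosDef)
    (β : ℝ) (hβ : 0 < β)
    (lam : ℝ) (hlam : 0 < lam)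
    (hΓlow : ∀ z : Fin p → ℝ, z ⬝ᵥ (Γ *ᵥ z) ≥ lam * (z ⬝ᵥ z))
    (α : ℝ) (hαpos : 0 < α)
    (T : EReal) (hT : 0 < T)
    (x : ℝ → Fin n → ℝ) (ν θhat : ℝ → Fin p → ℝ) (u : ℝ → Fin m → ℝ)
    (ϑ : ℝ → Fin p → ℝ)
    (hx : ∀ t : ℝ, 0 ≤ t → (t : EReal) < T →
      HasDerivAt x (f (x t) + G (x t) *ᵥ (u t + Φ (x t) *ᵥ θ)) t)
    (hν : ∀ t : ℝ, 0 ≤ t → (t : EReal) < T →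
      HasDerivAt ν (-(Γ *ᵥ psi h G Φ (x t))) t)
    (hθhat : ∀ t : ℝ, 0 ≤ t → (t : EReal) < T →
      HasDerivAt θhat (β • (Γ *ᵥ (ν t - θhat t))) t)
    (herr : ∀ t : ℝ, 0 ≤ t → (t : EReal) < T →
      (θ - ν t) ⬝ᵥ (Γ⁻¹ *ᵥ (θ - ν t)) ≤ ϑ t ⬝ᵥ (Γ⁻¹ *ᵥ ϑ t))
    (htracbf : ∀ t : ℝ, 0 ≤ t → (t : EReal) < T →
      fderiv ℝ h (x t) (f (x t) + G (x t) *ᵥ (u t + Φ (x t) *ᵥ θhat t)) ≥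
        -α * (h (x t) - (1 / 2) * (ϑ t ⬝ᵥ (Γ⁻¹ *ᵥ ϑ t)))
          + (2 / β) * (psi h G Φ (x t) ⬝ᵥ psi h G Φ (x t))) :
    ∀ t : ℝ, 0 ≤ t → (t : EReal) < T →
      ∃ D : ℝ,
        HasDerivAt (fun τ => hAhot h θ Γ (x τ) (ν τ) (θhat τ)) D t ∧
        D ≥ -α * hAhot h θ Γ (x t) (ν t) (θhat t)
          + (1 / 2) * (β - α / lam) * ((ν t - θhat t) ⬝ᵥ (ν t - θhat t)) := by
  intro t ht htT
  have hdet : IsUnit Γ.det := (isUnit_iff_isUnit_det Γ).1 hΓ.isUnit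
  have dh := ((hh.differentiable one_ne_zero) (x t)).hasFDerivAt.comp_hasDerivAt t (hx t ht htT)
  have de : HasDerivAt (fun τ => θ - ν τ) (Γ *ᵥ psi h G Φ (x t)) t := by
    simpa using (hν t ht htT).const_sub θ
  have dw : HasDerivAt (fun τ => ν τ - θhat τ)
      (Γ *ᵥ (-psi h G Φ (x t) - β • (ν t - θhat t))) t := by
    rw [mulVec_sub, mulVec_neg, mulVec_smul]
    exact (hν t ht htT).fun_sub (hθhat t ht htT)
  refine ⟨_, (dh.sub ((hΓ.hasDerivAt_inv_quadratic de).const_mul (1 / 2))).sub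
    ((hΓ.hasDerivAt_inv_quadratic dw).const_mul (1 / 2)), ?_⟩
  have hsplit : fderiv ℝ h (x t) (f (x t) + G (x t) *ᵥ (u t + Φ (x t) *ᵥ θ)) =
      fderiv ℝ h (x t) (f (x t) + G (x t) *ᵥ (u t + Φ (x t) *ᵥ θhat t))
        + psi h G Φ (x t) ⬝ᵥ (θ - ν t) + psi h G Φ (x t) ⬝ᵥ (ν t - θhat t) := by
    rw [add_assoc, ← dotProduct_add, sub_add_sub_cancel, ← fderiv_mulVec_mulVec, ← map_add,
      add_assoc, ← mulVec_add, add_assoc, ← mulVec_add, add_sub_cancel]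
  have hcbf := htracbf t ht htT
  have hbound := mul_le_mul_of_nonneg_left (herr t ht htT) hαpos.le
  have hyoung := two_mul_dotProduct_young hβ (psi h G Φ (x t)) (ν t - θhat t)
  have hinv : α * ((ν t - θhat t) ⬝ᵥ (Γ⁻¹ *ᵥ (ν t - θhat t))) ≤
      α / lam * ((ν t - θhat t) ⬝ᵥ (ν t - θhat t)) := by
    rw [div_mul_eq_mul_div, mul_div_assoc]
    refine mul_le_mul_of_nonneg_left ?_ hαpos.le
    rw [le_div_iff₀' hlam]
    exact mul_dotProduct_inv_mulVec_le hdet hlam.le hΓlow _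
  rw [hsplit, dotProduct_sub (ν t - θhat t), dotProduct_neg, dotProduct_smul, smul_eq_mul,
    dotProduct_comm (θ - ν t) (psi h G Φ (x t)),
    dotProduct_comm (ν t - θhat t) (psi h G Φ (x t))]
  unfold hAhot
  linarith
end
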